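/- Let F be a field of characteristic p > 0, let S ⊆ F be a nonempty set with pdeg(S) = k ∈ ℕ, and let {a_1, ..., a_k} be a p-basis of F^p(S). For r ∈ {1, ..., k} set t = k − r + 1; then annΩ^n_F(⋀^r dS) = Σ over all subsets {i_1 < ... < i_t} ⊆ {1, ..., k} of d a_{i_1} ∧ ... ∧ d a_{i_t} ∧ Ω^{n−t}(F). For r > k, annΩ^n_F(⋀^r dS) = Ω^n(F). -/

import Mathlib

set_option synthInstance.maxHeartbeats 1000000
set_option maxHeartbeats 1000000

open ExteriorAlgebra

noncomputable section Preamble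

variable (F : Type) [Field F] (p : ℕ)

/-- The subfield `F^{p^t}(C)` of `F` generated by the `p^t`-th powers and the set `C`. -/
def pClosureT (t : ℕ) (C : Set F) : Subfield F :=
  Subfield.closure ((Set.range fun x : F => x ^ p ^ t) ∪ C)

/-- The subfield `F^p(C)` of `F` generated by the `p`-th powers and the set `C`. -/
def pClosure (C : Set F) : Subfield F := pClosureT F p 1 C

/-- The degree `[B(A) : B]` for a subfield `B` of `F` and a subset `A ⊆ F`. -/
def relDeg (B : Subfield F) (A : Set F) : ℕ :=
  Module.finrank B (IntermediateField.adjoin B A)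

/-- `pdeg A = k`, i.e. `[F^p(A) : F^p] = p ^ k`. -/
def pDegEq (A : Set F) (k : ℕ) : Prop :=
  relDeg F (pClosure F p ∅) A = p ^ k

/-- A finite family `a : Fin n → F` is `p`-independent if `[F^p(a₁,…,aₙ) : F^p] = pⁿ`. -/
def pIndep {n : ℕ} (a : Fin n → F) : Prop :=
  pDegEq F p (Set.range a) n

/-- The exterior algebra of the absolute differential forms of `F`; the spaces `Ωⁿ(F)`
are its graded pieces and the wedge product is its multiplication. -/
abbrev ExtOmega := ExteriorAlgebra F (Ω[F⁄ℤ])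

/-- The differential `d a` of an element `a : F`, viewed in the exterior algebra. -/
def dform (a : F) : ExtOmega F :=
  ExteriorAlgebra.ι F (KaehlerDifferential.D ℤ F a)

/-- The space `Ωⁿ(F)` of `n`-differential forms, as a submodule of the exterior algebra;
it is `0` for `n < 0`. -/
def OmegaPow (n : ℤ) : Submodule F (ExtOmega F) :=
  if 0 ≤ n then ⋀[F]^(n.toNat) (Ω[F⁄ℤ]) else ⊥

/-- The wedge product `d a₁ ∧ … ∧ d aₙ` of the differentials of a family. -/
def dwedge {n : ℕ} (a : Fin n → F) : ExtOmega F :=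
  (List.ofFn fun i => dform F (a i)).prod

/-- The annihilator `annΩ^n_F(U)` of a set `U` of differential forms. -/
def annOmega (n : ℕ) (U : Set (ExtOmega F)) : Submodule F (ExtOmega F) :=
  OmegaPow F n ⊓ ⨅ u ∈ U, LinearMap.ker (LinearMap.mulRight F u)

/-- The logarithmic differential form `(dx₁/x₁) ∧ … ∧ (dxₙ/xₙ)`. -/
def logForm {n : ℕ} (x : Fin n → F) : ExtOmega F :=
  (List.ofFn fun i => ExteriorAlgebra.ι F ((x i)⁻¹ • KaehlerDifferential.D ℤ F (x i))).prod

/-- The group `ν_n(F)`, additively generated by the logarithmic differential forms;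
it is `0` for `n < 0`. -/
def nuPow (n : ℤ) : AddSubgroup (ExtOmega F) :=
  if 0 ≤ n then
    AddSubgroup.closure
      {ω | ∃ x : Fin n.toNat → F, (∀ i, x i ≠ 0) ∧ ω = logForm F x}
  else ⊥

/-- The annihilator `ann ν^n_F(U)`. -/
def annNu (n : ℕ) (U : Set (ExtOmega F)) : AddSubgroup (ExtOmega F) :=
  (annOmega F n U).toAddSubgroup ⊓ nuPow F n

/-- `η ∧ W` for a form `η` and a subspace `W`. -/
def wedgeL (η : ExtOmega F) (W : Submodule F (ExtOmega F)) : Submodule F (ExtOmega F) :=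
  W.map (LinearMap.mulLeft F η)

/-- The set `dS₁ ∧ … ∧ dSᵣ` for sets `S₁, …, Sᵣ ⊆ F`. -/
def dSet {r : ℕ} (S : Fin r → Set F) : Set (ExtOmega F) :=
  {ω | ∃ s : Fin r → F, (∀ i, s i ∈ S i) ∧ ω = dwedge F s}

/-- The additive subgroup `[dy₁/y₁ ∧ … ∧ dy_t/y_t ∣ yᵢ ∈ K^*] ∧ ν_m(F)` of `Ωⁿ(F)`
(for `n = t + m`). -/
def logWedgeNu (K : Set F) (t : ℕ) (m : ℤ) : AddSubgroup (ExtOmega F) :=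
  AddSubgroup.closure
    {ω | ∃ y : Fin t → F, (∀ i, y i ∈ K ∧ y i ≠ 0) ∧
      ∃ χ ∈ nuPow F m, ω = logForm F y * χ}

variable (E : Type) [Field E] [Algebra F E]

/-- The restriction map `Ω(F) → Ω(E)` on exterior algebras of differential forms,
induced by the inclusion `F ⊆ E`; it sends `d a` to `d a` and `x dа₁ ∧ … ∧ daₙ` to
the corresponding form over `E`. -/
def resMap : ExtOmega F →+* ExtOmega E :=
  letI : Algebra F (ExtOmega E) :=
    ((algebraMap E (ExtOmega E)).comp (algebraMap F E)).toAlgebra'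
      (fun c x => Algebra.commutes (algebraMap F E c) x)
  (ExteriorAlgebra.lift F ⟨{
      toFun := fun w =>
        ExteriorAlgebra.ι E (KaehlerDifferential.map ℤ ℤ F E w)
      map_add' := fun x y => by simp
      map_smul' := fun c x => by
        simp only [map_smul, RingHom.id_apply]
        rw [← algebraMap_smul E c (KaehlerDifferential.map ℤ ℤ F E x), map_smul,
          Algebra.smul_def, Algebra.smul_def]
        rfl },
    fun m => ExteriorAlgebra.ι_sq_zero _⟩).toRingHom

/-- The kernel `Ωⁿ(E/F)` of the restriction map `Ωⁿ(F) → Ωⁿ(E)`. -/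
def OmegaKer (n : ℕ) : Set (ExtOmega F) :=
  {ω | ω ∈ OmegaPow F n ∧ resMap F E ω = 0}

/-- The kernel `ν_n(E/F) = Ωⁿ(E/F) ∩ ν_n(F)`. -/
def nuKer (n : ℕ) : Set (ExtOmega F) :=
  OmegaKer F E n ∩ (nuPow F n : Set (ExtOmega F))

end Preamble

theorem exists_maximal_subfield_notMem {F : Type*} [Field F] {K : Subfield F} {a : F}
    (ha : a ∉ K) : ∃ M : Subfield F, K ≤ M ∧ Maximal (fun L : Subfield F => a ∉ L) M := by
  refine zorn_le_nonempty₀ {L : Subfield F | a ∉ L} (fun c hc hchain y hy => ?_) K ha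
  refine ⟨sSup c, ?_, fun z hz => le_sSup hz⟩
  rw [Set.mem_ofPred_eq, ← SetLike.mem_coe, Subfield.coe_sSup_of_directedOn ⟨y, hy⟩ hchain.directedOn]
  simpa using fun L hL => hc hL

theorem isIntegral_of_pow_mem {F : Type*} [Field F] {M : Subfield F} {p : ℕ} (hp : p ≠ 0) {x : F}
    (hx : x ^ p ∈ M) : IsIntegral M x :=
  IsIntegral.of_pow (Nat.pos_of_ne_zero hp) (isIntegral_algebraMap (x := (⟨x ^ p, hx⟩ : M)))

theorem minpoly_of_pow_mem {F : Type*} [Field F] (p : ℕ) [Fact p.Prime] [CharP F p]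
    {M : Subfield F} {x : F} (hxp : x ^ p ∈ M) (hx : x ∉ M) :
    minpoly M x = Polynomial.X ^ p - Polynomial.C ⟨x ^ p, hxp⟩ := by
  have hp : p.Prime := Fact.out
  symm
  apply minpoly.eq_of_irreducible_of_monic
  · refine X_pow_sub_C_irreducible_of_prime hp fun b hb => hx ?_
    have h : (b : F) ^ p = x ^ p := congrArg Subtype.val hb
    have : (b : F) = x := frobenius_inj F p h
    exact this ▸ b.2
  · simp [Polynomial.aeval_def]
    exact sub_self _
  · exact Polynomial.monic_X_pow_sub_C _ hp.ne_zero

theorem adjoin_eq_top_of_maximal_notMem {F : Type*} [Field F] (p : ℕ) [Fact p.Prime] [CharP F p]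
    {M : Subfield F} {a : F} (hM : Maximal (fun L : Subfield F => a ∉ L) M)
    (hp : ∀ x : F, x ^ p ∈ M) : IntermediateField.adjoin M {a} = ⊤ := by
  have hfin (y : F) : IsIntegral M y := isIntegral_of_pow_mem (Fact.out : p.Prime).ne_zero (hp y)
  have hrank {y : F} (hy : y ∉ M) : Module.finrank M (IntermediateField.adjoin M {y}) = p := by
    rw [IntermediateField.adjoin.finrank (hfin y), minpoly_of_pow_mem p (hp y) hy,
      Polynomial.natDegree_X_pow_sub_C]
  refine eq_top_iff.2 fun x _ => ?_
  by_cases hx : x ∈ M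
  · exact (IntermediateField.adjoin M {a}).algebraMap_mem ⟨x, hx⟩
  have hle : M ≤ (IntermediateField.adjoin M {x}).toSubfield := fun y hy =>
    (IntermediateField.adjoin M {x}).algebraMap_mem ⟨y, hy⟩
  have hax : a ∈ IntermediateField.adjoin M {x} := by
    by_contra h
    exact hx (hM.2 (y := (IntermediateField.adjoin M {x}).toSubfield) h hle
      (IntermediateField.mem_adjoin_simple_self M x))
  have := IntermediateField.adjoin.finiteDimensional (hfin x)
  rw [IntermediateField.eq_of_le_of_finrank_eq (IntermediateField.adjoin_simple_le_iff.2 hax)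
    ((hrank hM.1).trans (hrank hx).symm)]
  exact IntermediateField.mem_adjoin_simple_self M x

theorem D_ne_zero_of_adjoin_eq_top {F : Type*} [Field F] (p : ℕ) [Fact p.Prime] [CharP F p]
    {M : Subfield F} {a : F} (ha : a ∉ M) (hap : a ^ p ∈ M)
    (htop : IntermediateField.adjoin M {a} = ⊤) : KaehlerDifferential.D M F a ≠ 0 := by
  intro h0
  have hmin := minpoly_of_pow_mem p hap ha
  have hint : IsIntegral M a := isIntegral_of_pow_mem (Fact.out : p.Prime).ne_zero hap
  have halg : Algebra.adjoin M {a} = ⊤ := by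
    have := IntermediateField.adjoin_simple_toSubalgebra_of_isAlgebraic hint.isAlgebraic
    rw [← this, htop, IntermediateField.top_toSubalgebra]
  have hsub : Subsingleton (Ω[F⁄M]) := by
    have hD : ∀ x : F, KaehlerDifferential.D M F x = 0 := by
      have : KaehlerDifferential.D M F = 0 := by
        apply Derivation.ext_of_adjoin_eq_top {a} halg
        simpa [Set.EqOn] using h0
      simp [this]
    rw [← Submodule.subsingleton_iff (R := F), ← subsingleton_iff_bot_eq_top,
      ← KaehlerDifferential.span_range_derivation M F, eq_comm, Submodule.span_eq_bot]
    rintro _ ⟨x, rfl⟩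
    exact hD x
  have : Module.Finite M F := by
    have := IntermediateField.adjoin.finiteDimensional hint
    rw [htop] at this
    exact Module.Finite.equiv (IntermediateField.topEquiv (F := M) (E := F)).toLinearEquiv
  have : Algebra.FormallyUnramified M F := ⟨hsub⟩
  have hsep : Algebra.IsSeparable M F := Algebra.FormallyUnramified.isSeparable M F
  have h := hsep.isSeparable' a
  rw [IsSeparable, Polynomial.separable_iff_derivative_ne_zero (minpoly.irreducible hint),
    hmin] at h
  exact h (by simp [Polynomial.derivative_X_pow, CharP.cast_eq_zero])

theorem exists_subfield_D_ne_zero {F : Type*} [Field F] (p : ℕ) [Fact p.Prime] [CharP F p]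
    {K : Subfield F} (hK : ∀ x : F, x ^ p ∈ K) {a : F} (ha : a ∉ K) :
    ∃ M : Subfield F, K ≤ M ∧ KaehlerDifferential.D M F a ≠ 0 := by
  obtain ⟨M, hKM, hM⟩ := exists_maximal_subfield_notMem ha
  exact ⟨M, hKM, D_ne_zero_of_adjoin_eq_top p hM.1 (hKM (hK a))
    (adjoin_eq_top_of_maximal_notMem p hM fun x => hKM (hK x))⟩

theorem finrank_adjoin_le_pow_card {K F : Type*} [Field K] [Field F] [Algebra K F] {p : ℕ}
    (hp : p ≠ 0) (hK : ∀ x : F, x ^ p ∈ (algebraMap K F).range) (s : Finset F) :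
    Module.finrank K (IntermediateField.adjoin K (s : Set F)) ≤ p ^ s.card := by
  classical
  induction s using Finset.induction_on with
  | empty => rw [Finset.coe_empty, IntermediateField.adjoin_empty, IntermediateField.finrank_bot]; simp
  | insert x s hx ih =>
    rw [Finset.coe_insert, Set.insert_eq, IntermediateField.adjoin_union,
      Finset.card_insert_of_notMem hx, pow_succ']
    refine (IntermediateField.finrank_sup_le _ _).trans (Nat.mul_le_mul ?_ ih)
    obtain ⟨c, hc⟩ := hK x
    have hm := Polynomial.monic_X_pow_sub_C c hp
    have h0 : Polynomial.aeval x (Polynomial.X ^ p - Polynomial.C c) = 0 := by simp [hc]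
    rw [IntermediateField.adjoin.finrank ⟨_, hm, h0⟩]
    exact (Polynomial.natDegree_le_of_dvd (minpoly.dvd K x h0) hm.ne_zero).trans
      (Polynomial.natDegree_X_pow_sub_C).le

theorem D_mem_span_of_mem_closure {F : Type*} [Field F] {p : ℕ} [CharP F p] {S : Set F} {x : F}
    (hx : x ∈ Subfield.closure (Set.range (fun y : F => y ^ p) ∪ S)) :
    KaehlerDifferential.D ℤ F x ∈ Submodule.span F (KaehlerDifferential.D ℤ F '' S) := by
  induction hx using Subfield.closure_induction with
  | mem x hx =>
    obtain ⟨y, rfl⟩ | hx := hx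
    · simp [Derivation.leibniz_pow]
      rw [← Nat.cast_smul_eq_nsmul F]
      simp
    · exact Submodule.subset_span ⟨x, hx, rfl⟩
  | one => simp
  | add x y _ _ hx hy => simpa using add_mem hx hy
  | neg x _ hx => simpa using hx
  | inv x _ hx =>
    rw [Derivation.leibniz_inv]
    exact Submodule.smul_mem _ _ hx
  | mul x y _ _ hx hy =>
    rw [Derivation.leibniz]
    exact add_mem (Submodule.smul_mem _ _ hy) (Submodule.smul_mem _ _ hx)

theorem pow_mem_pClosure_empty {F : Type} [Field F] (p : ℕ) (x : F) : x ^ p ∈ pClosure F p ∅ :=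
  Subfield.subset_closure (Or.inl ⟨x, by simp⟩)

theorem notMem_adjoin_of_pIndep {F : Type} [Field F] {p : ℕ} (hp : 1 < p) {k : ℕ} {a : Fin k → F}
    (ha : pIndep F p a) (i : Fin k) :
    a i ∉ IntermediateField.adjoin (pClosure F p ∅) (a '' {i}ᶜ) := by
  classical
  intro hi
  have heq : IntermediateField.adjoin (pClosure F p ∅) (Set.range a) =
      IntermediateField.adjoin (pClosure F p ∅) (a '' {i}ᶜ) := by
    refine le_antisymm (IntermediateField.adjoin_le_iff.2 ?_)
      (IntermediateField.adjoin.mono _ _ _ (Set.image_subset_range _ _))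
    rintro _ ⟨j, rfl⟩
    by_cases hj : j = i
    · exact hj ▸ hi
    · exact IntermediateField.subset_adjoin _ _ ⟨j, hj, rfl⟩
  have hs : a '' {i}ᶜ = ((Finset.univ.erase i).image a : Finset F) := by
    ext; simp
  have hle := finrank_adjoin_le_pow_card (K := pClosure F p ∅) (p := p) (by lia)
    (fun x => ⟨⟨x ^ p, pow_mem_pClosure_empty p x⟩, rfl⟩) ((Finset.univ.erase i).image a)
  have hcard : ((Finset.univ.erase i).image a).card < k :=
    Finset.card_image_le.trans_lt (by
      simpa using Finset.card_erase_lt_of_mem (Finset.mem_univ i))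
  have ha' : Module.finrank (pClosure F p ∅)
    (IntermediateField.adjoin (pClosure F p ∅) (Set.range a)) = p ^ k := ha
  rw [← hs, ← heq, ha'] at hle
  exact absurd hle (not_le.2 (Nat.pow_lt_pow_right hp hcard))

theorem linearIndependent_D_of_pIndep {F : Type} [Field F] {p : ℕ} [Fact p.Prime] [CharP F p]
    {k : ℕ} {a : Fin k → F} (ha : pIndep F p a) :
    LinearIndependent F fun i => KaehlerDifferential.D ℤ F (a i) := by
  rw [linearIndependent_iff_notMem_span]
  intro i hi
  obtain ⟨M, hKM, hM⟩ := exists_subfield_D_ne_zero p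
    (K := (IntermediateField.adjoin (pClosure F p ∅) (a '' {i}ᶜ)).toSubfield)
    (fun x => (IntermediateField.adjoin (pClosure F p ∅) (a '' {i}ᶜ)).algebraMap_mem
      ⟨x ^ p, pow_mem_pClosure_empty p x⟩)
    (notMem_adjoin_of_pIndep (Fact.out : p.Prime).one_lt ha i)
  have hle : Submodule.span F ((fun i => KaehlerDifferential.D ℤ F (a i)) '' (Set.univ \ {i})) ≤
      LinearMap.ker (KaehlerDifferential.map ℤ M F F) := by
    rw [Submodule.span_le]
    rintro _ ⟨j, hj, rfl⟩
    have hjM : a j ∈ M := hKM (IntermediateField.subset_adjoin _ _ ⟨j, by simpa using hj, rfl⟩)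
    have := (KaehlerDifferential.D M F).map_algebraMap ⟨a j, hjM⟩
    rw [SetLike.mem_coe, LinearMap.mem_ker, KaehlerDifferential.map_D]
    exact this
  have := hle hi
  rw [LinearMap.mem_ker, KaehlerDifferential.map_D] at this
  exact hM this

theorem span_D_image_eq_of_pClosure_eq {F : Type} [Field F] {p : ℕ} [CharP F p] {S T : Set F}
    (h : pClosure F p S = pClosure F p T) :
    Submodule.span F (KaehlerDifferential.D ℤ F '' S) =
      Submodule.span F (KaehlerDifferential.D ℤ F '' T) := by
  have key {S T : Set F} (h : pClosure F p S = pClosure F p T) :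
      Submodule.span F (KaehlerDifferential.D ℤ F '' S) ≤
        Submodule.span F (KaehlerDifferential.D ℤ F '' T) := by
    rw [Submodule.span_le]
    rintro _ ⟨s, hs, rfl⟩
    have hs' : s ∈ pClosure F p S := Subfield.subset_closure (Or.inr hs)
    rw [h, pClosure, pClosureT, pow_one] at hs'
    exact D_mem_span_of_mem_closure hs'
  exact le_antisymm (key h) (key h.symm)

theorem contractLeft_list_prod_mul {K V : Type*} [Field K] [AddCommGroup V] [Module K V]
    (d : Module.Dual K V) (l : List V) (hl : ∀ v ∈ l, d v = 0) (x : ExteriorAlgebra K V)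
    (hx : (l.map (ι K)).prod * x = 0) :
    (l.map (ι K)).prod * CliffordAlgebra.contractLeft (Q := 0) d x = 0 := by
  have key : CliffordAlgebra.contractLeft (Q := 0) d ((l.map (ι K)).prod * x) =
      (-1 : K) ^ l.length • ((l.map (ι K)).prod * CliffordAlgebra.contractLeft (Q := 0) d x) := by
    clear hx
    induction l with
    | nil => simp
    | cons v l ih =>
      rw [List.map_cons, List.prod_cons, mul_assoc, mul_assoc]
      refine (CliffordAlgebra.contractLeft_ι_mul d v _).trans ?_
      rw [ih fun w hw => hl w (List.mem_cons_of_mem v hw), hl v (by simp), zero_smul, zero_sub,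
        List.length_cons, pow_succ', mul_smul, neg_one_smul, mul_smul_comm]
  rw [hx, map_zero] at key
  exact (smul_eq_zero_iff_right (pow_ne_zero _ (neg_ne_zero.2 one_ne_zero))).1 key.symm

theorem LinearIndependent.exists_dual_eq_one_of_fin_succ {K V : Type*} [Field K] [AddCommGroup V]
    [Module K V] {k : ℕ} {e : Fin (k + 1) → V} (he : LinearIndependent K e) :
    ∃ d : Module.Dual K V, d (e 0) = 1 ∧ ∀ i : Fin k, d (e i.succ) = 0 := by
  obtain ⟨d, hd⟩ := LinearMap.exists_extend
    ((Finsupp.lapply (0 : Fin (k + 1)) : (Fin (k + 1) →₀ K) →ₗ[K] K) ∘ₗ he.repr)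
  have h (i : Fin (k + 1)) : d (e i) = Finsupp.single i (1 : K) 0 := by
    have := LinearMap.congr_fun hd ⟨e i, Submodule.subset_span ⟨i, rfl⟩⟩
    rw [LinearMap.comp_apply, LinearMap.comp_apply, he.repr_eq_single i _ rfl] at this
    exact this
  exact ⟨d, by simp [h], fun i => by simp [h, Fin.succ_ne_zero]⟩

/-- A form killed by all left products of `r` members of a linearly
independent family of size `k` is a combination of products of `t` members, for `t + r ≤ k + 1`. -/
theorem mem_iSup_range_mulLeft_of_forall_list_prod_mul_eq_zero {K V : Type*} [Field K]
    [AddCommGroup V] [Module K V] {k : ℕ} {e : Fin k → V} (he : LinearIndependent K e) {r t : ℕ}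
    (h : t + r ≤ k + 1) {ω : ExteriorAlgebra K V}
    (hω : ∀ l : List V, l.length = r → (∀ v ∈ l, v ∈ Set.range e) → (l.map (ι K)).prod * ω = 0) :
    ω ∈ ⨆ c : Fin t ↪o Fin k,
      LinearMap.range (LinearMap.mulLeft K (List.ofFn fun j => ι K (e (c j))).prod) := by
  induction k generalizing r t ω with
  | zero =>
    obtain _ | t := t
    · exact Submodule.mem_iSup_of_mem (Fin.castLEOrderEmb le_rfl) ⟨ω, by simp⟩
    · obtain rfl : r = 0 := by lia
      have : ω = 0 := by simpa using hω [] rfl (by simp)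
      exact this ▸ zero_mem _
  | succ k ih =>
    obtain _ | t := t
    · exact Submodule.mem_iSup_of_mem (Fin.castLEOrderEmb (Nat.zero_le _)) ⟨ω, by simp⟩
    obtain _ | r := r
    · have : ω = 0 := by simpa using hω [] rfl (by simp)
      exact this ▸ zero_mem _
    obtain ⟨d, hd0, hd⟩ := he.exists_dual_eq_one_of_fin_succ
    have he' : LinearIndependent K fun i : Fin k => e i.succ :=
      he.comp Fin.succ (Fin.succ_injective k)
    have hker {l : List V} (hl : ∀ v ∈ l, v ∈ Set.range fun i : Fin k => e i.succ) :
        ∀ v ∈ l, d v = 0 := by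
      intro v hv
      obtain ⟨i, rfl⟩ := hl v hv
      exact hd i
    have hmem {l : List V} (hl : ∀ v ∈ l, v ∈ Set.range fun i : Fin k => e i.succ) :
        ∀ v ∈ l, v ∈ Set.range e := by
      intro v hv
      obtain ⟨i, rfl⟩ := hl v hv
      exact ⟨_, rfl⟩
    set α := CliffordAlgebra.contractLeft (Q := 0) d ω with hα
    set β := CliffordAlgebra.contractLeft (Q := 0) d (ι K (e 0) * ω) with hβ
    have hsum : ω = ι K (e 0) * α + β := by
      have : β = d (e 0) • ω - ι K (e 0) * α := CliffordAlgebra.contractLeft_ι_mul d _ _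
      rw [this, hd0, one_smul, add_sub_cancel]
    have hαmem := ih he' (r := r + 1) (t := t) (by lia) (ω := α) fun l hlen hl =>
      contractLeft_list_prod_mul d l (hker hl) ω (hω l hlen (hmem hl))
    have hβmem := ih he' (r := r) (t := t + 1) (by lia) (ω := β) fun l hlen hl => by
      refine contractLeft_list_prod_mul d l (hker hl) _ ?_
      have := hω (l ++ [e 0]) (by simp [hlen]) (by
        intro v hv
        rcases List.mem_append.1 hv with hv | hv
        · exact hmem hl v hv
        · exact ⟨0, (List.mem_singleton.1 hv).symm⟩)
      simpa [mul_assoc] using this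
    rw [hsum]
    refine add_mem ?_ ?_
    · have hle : (⨆ c : Fin t ↪o Fin k, LinearMap.range (LinearMap.mulLeft K
          (List.ofFn fun j => ι K (e (c j).succ)).prod)) ≤
          Submodule.comap (LinearMap.mulLeft K (ι K (e 0))) (⨆ c : Fin (t + 1) ↪o Fin (k + 1),
            LinearMap.range (LinearMap.mulLeft K (List.ofFn fun j => ι K (e (c j))).prod)) := by
        refine iSup_le fun c => ?_
        rintro _ ⟨x, rfl⟩
        have hmono : StrictMono (Fin.cons 0 (Fin.succ ∘ c) : Fin (t + 1) → Fin (k + 1)) := by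
          intro i j hij
          induction j using Fin.cases with
          | zero => exact absurd hij (Fin.not_lt_zero i)
          | succ j =>
            induction i using Fin.cases with
            | zero => simp
            | succ i => simpa using hij
        refine Submodule.mem_iSup_of_mem (OrderEmbedding.ofStrictMono _ hmono) ⟨x, ?_⟩
        simp [List.ofFn_succ]
      exact hle hαmem
    · revert hβmem
      apply SetLike.le_def.1
      refine iSup_le fun c => ?_
      exact le_iSup_of_le (c.trans (Fin.succOrderEmb k)) le_rfl

theorem ι_mul_eq_smul_mul_ι {K V : Type*} [CommRing K] [AddCommGroup V] [Module K V] (v : V)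
    {n : ℕ} {x : ExteriorAlgebra K V} (hx : x ∈ ⋀[K]^n V) :
    ι K v * x = (-1 : K) ^ n • (x * ι K v) := by
  induction hx using Submodule.pow_induction_on_left' with
  | algebraMap c => simp [Algebra.commutes]
  | add x y i _ _ hx hy => rw [mul_add, hx, hy, add_mul, smul_add]
  | mem_mul m hm i x _ ih =>
    obtain ⟨w, rfl⟩ := hm
    rw [← mul_assoc, eq_neg_of_add_eq_zero_left (ι_add_mul_swap v w), neg_mul, mul_assoc, ih,
      pow_succ', mul_smul_comm, mul_assoc, mul_smul, neg_one_smul]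

theorem mul_eq_smul_mul_of_mem_exteriorPower {K V : Type*} [CommRing K] [AddCommGroup V]
    [Module K V] {m n : ℕ} {x y : ExteriorAlgebra K V} (hx : x ∈ ⋀[K]^m V) (hy : y ∈ ⋀[K]^n V) :
    x * y = (-1 : K) ^ (m * n) • (y * x) := by
  induction hx using Submodule.pow_induction_on_left' with
  | algebraMap c => simp [Algebra.commutes]
  | add x z i _ _ hx hz => rw [add_mul, hx, hz, mul_add, smul_add]
  | mem_mul m hm i x _ ih =>
    obtain ⟨w, rfl⟩ := hm
    rw [mul_assoc, ih, mul_smul_comm, ← mul_assoc, ι_mul_eq_smul_mul_ι w hy, smul_mul_assoc,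
      smul_smul, mul_assoc, ← pow_add]
    congr 2
    rw [Nat.succ_eq_add_one]
    ring

theorem mul_eq_zero_comm_of_mem_exteriorPower {K V : Type*} [CommRing K] [AddCommGroup V]
    [Module K V] {m n : ℕ} {x y : ExteriorAlgebra K V} (hx : x ∈ ⋀[K]^m V) (hy : y ∈ ⋀[K]^n V)
    (h : x * y = 0) : y * x = 0 := by
  rw [mul_eq_smul_mul_of_mem_exteriorPower hy hx, h, smul_zero]

theorem span_image_ι_range_pow_eq_bot {K V : Type*} [CommRing K] [AddCommGroup V] [Module K V]
    {k m : ℕ} (e : Fin k → V) (h : k < m) :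
    (Submodule.span K (ι K '' Set.range e)) ^ m = ⊥ := by
  rw [Submodule.span_pow, Submodule.span_eq_bot]
  intro x hx
  obtain ⟨f, rfl⟩ := Set.mem_pow.1 hx
  have hf (i : Fin m) : ∃ j, ι K (e j) = f i := by
    obtain ⟨_, ⟨j, rfl⟩, hj⟩ := (f i).2
    exact ⟨j, hj⟩
  choose g hg using hf
  simp_rw [← hg]
  rw [← ιMulti_apply (R := K) (fun i => e (g i))]
  refine AlternatingMap.map_eq_zero_of_not_injective _ _ fun hinj => ?_
  have := Fintype.card_le_of_injective g fun i j hij => hinj (by simp [hij])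
  simp at this
  lia

open scoped Pointwise in
theorem mem_annOmega_dSet_iff {F : Type} [Field F] {p : ℕ} [CharP F p] {n k r : ℕ} {S : Set F}
    {a : Fin k → F} (hgen : pClosure F p (Set.range a) = pClosure F p S) {ω : ExtOmega F} :
    ω ∈ annOmega F n (dSet F fun _ : Fin r => S) ↔ ω ∈ ⋀[F]^n (Ω[F⁄ℤ]) ∧
      ∀ x ∈ (Submodule.span F
        (ι F '' Set.range fun i => KaehlerDifferential.D ℤ F (a i))) ^ r, ω * x = 0 := by
  have hspan : Submodule.span F (ι F '' Set.range fun i => KaehlerDifferential.D ℤ F (a i)) =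
      Submodule.span F (dform F '' S) := by
    have himage : dform F '' S = ι F '' (KaehlerDifferential.D ℤ F '' S) := by
      rw [Set.image_image]; rfl
    have hrange : (Set.range fun i => KaehlerDifferential.D ℤ F (a i)) =
        KaehlerDifferential.D ℤ F '' Set.range a := by
      rw [← Set.range_comp]; rfl
    rw [himage, hrange, Submodule.span_image, Submodule.span_image,
      span_D_image_eq_of_pClosure_eq hgen]
  have hdSet : dSet F (fun _ : Fin r => S) = (dform F '' S) ^ r := by
    ext u
    rw [Set.mem_pow]
    constructor
    · rintro ⟨s, hs, rfl⟩
      exact ⟨fun i => ⟨dform F (s i), s i, hs i, rfl⟩, rfl⟩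
    · rintro ⟨f, rfl⟩
      choose s hs hsf using fun i => (f i).2
      exact ⟨s, hs, by simp_rw [← hsf]; rfl⟩
  have hann : (∀ x ∈ Submodule.span F (dform F '' S) ^ r, ω * x = 0) ↔
      ∀ x ∈ (dform F '' S) ^ r, ω * x = 0 := by
    rw [Submodule.span_pow]
    exact Submodule.span_le (p := LinearMap.ker (LinearMap.mulLeft F ω))
  rw [hspan, hann, annOmega, hdSet]
  simp [OmegaPow]

theorem iSup_wedgeL_OmegaPow_eq {F : Type} [Field F] {n k t : ℕ} (a : Fin k → F) :
    ⨆ c : Fin t ↪o Fin k, wedgeL F (dwedge F fun j => a (c j)) (OmegaPow F ((n : ℤ) - t)) =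
      ⋀[F]^n (Ω[F⁄ℤ]) ⊓ ⨆ c : Fin t ↪o Fin k,
        LinearMap.range (LinearMap.mulLeft F (dwedge F fun j => a (c j))) := by
  have hdeg (c : Fin t ↪o Fin k) : (dwedge F fun j => a (c j)) ∈ ⋀[F]^t (Ω[F⁄ℤ]) :=
    ιMulti_range F t ⟨fun j => KaehlerDifferential.D ℤ F (a (c j)), rfl⟩
  apply le_antisymm
  · refine iSup_le fun c => ?_
    refine le_inf ?_ (le_iSup_of_le c LinearMap.map_le_range)
    rintro _ ⟨x, hx, rfl⟩
    by_cases h : t ≤ n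
    · have hx' : x ∈ ⋀[F]^(n - t) (Ω[F⁄ℤ]) := by
        rwa [OmegaPow, if_pos (by lia), show ((n : ℤ) - t).toNat = n - t by lia] at hx
      have := SetLike.GradedMul.mul_mem (A := fun i : ℕ => ⋀[F]^i (Ω[F⁄ℤ])) (hdeg c) hx'
      rwa [Nat.add_sub_cancel' h] at this
    · have hx' : x = 0 := by
        rwa [OmegaPow, if_neg (by lia)] at hx
      simp [hx']
  · rintro ω ⟨hω, hsup⟩
    have hle : ⨆ c : Fin t ↪o Fin k,
        LinearMap.range (LinearMap.mulLeft F (dwedge F fun j => a (c j))) ≤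
        Submodule.comap (GradedAlgebra.proj (fun i : ℕ => ⋀[F]^i (Ω[F⁄ℤ])) n)
          (⨆ c : Fin t ↪o Fin k,
            wedgeL F (dwedge F fun j => a (c j)) (OmegaPow F ((n : ℤ) - t))) := by
      refine iSup_le fun c => ?_
      rintro _ ⟨x, rfl⟩
      rw [Submodule.mem_comap, GradedAlgebra.proj_apply, LinearMap.mulLeft_apply,
        DirectSum.coe_decompose_mul_of_left_mem (fun i : ℕ => ⋀[F]^i (Ω[F⁄ℤ])) n (hdeg c)]
      split_ifs with h
      · refine Submodule.mem_iSup_of_mem c ⟨_, ?_, rfl⟩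
        rw [OmegaPow, if_pos (by lia), show ((n : ℤ) - t).toNat = n - t by lia]
        exact SetLike.coe_mem _
      · exact zero_mem _
    have := hle hsup
    rwa [Submodule.mem_comap, GradedAlgebra.proj_apply,
      DirectSum.decompose_of_mem_same (fun i : ℕ => ⋀[F]^i (Ω[F⁄ℤ])) hω] at this

/-- Proposition 3.5. For a nonempty `S ⊆ F` with `pdeg S = k` and a
`p`-basis `{a₁, …, a_k}` of `F^p(S)`: for `r ∈ {1, …, k}` and `t = k − r + 1`,
`annΩ^n_F(⋀^r dS) = Σ_{i₁<…<i_t} d a_{i₁} ∧ … ∧ d a_{i_t} ∧ Ω^{n−t}(F)`;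
and for `r > k`, `annΩ^n_F(⋀^r dS) = Ωⁿ(F)`. -/
theorem stmt8 (F : Type) [Field F] (p : ℕ) [Fact p.Prime] [CharP F p]
    (n k : ℕ) (S : Set F) (hS : S.Nonempty) (hdeg : pDegEq F p S k)
    (a : Fin k → F) (ha : pIndep F p a)
    (hgen : pClosure F p (Set.range a) = pClosure F p S) (r : ℕ) :
    (1 ≤ r → r ≤ k →
      annOmega F n (dSet F fun _ : Fin r => S) =
        ⨆ c : Fin (k - r + 1) ↪o Fin k,
          wedgeL F (dwedge F fun j => a (c j))
            (OmegaPow F ((n : ℤ) - (k - r + 1)))) ∧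
    (k < r → annOmega F n (dSet F fun _ : Fin r => S) = OmegaPow F n) := by
  have hpow (m : ℕ) : (Submodule.span F
      (ι F '' Set.range fun i => KaehlerDifferential.D ℤ F (a i))) ^ m ≤ ⋀[F]^m (Ω[F⁄ℤ]) :=
    pow_le_pow_left₀ bot_le (Submodule.span_le.2 (Set.image_subset_range _ _)) m
  refine ⟨fun _ hr => ?_, fun hr => ?_⟩
  · have hcast : (n : ℤ) - (k - r + 1) = (n : ℤ) - ((k - r + 1 : ℕ) : ℤ) := by
      push_cast [hr]; ring
    rw [hcast, iSup_wedgeL_OmegaPow_eq]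
    ext ω
    rw [mem_annOmega_dSet_iff hgen, Submodule.mem_inf]
    refine and_congr_right fun hω => ⟨fun h => ?_, fun h x hx => ?_⟩
    · refine mem_iSup_range_mulLeft_of_forall_list_prod_mul_eq_zero
        (linearIndependent_D_of_pIndep ha) (r := r) (by lia) fun l hlen hl => ?_
      have hl' : (l.map (ι F)).prod ∈ (Submodule.span F
          (ι F '' Set.range fun i => KaehlerDifferential.D ℤ F (a i))) ^ r := by
        subst hlen
        refine Submodule.pow_subset_pow _ (Set.mem_pow.2
          ⟨fun i => ⟨ι F (l.get i), Submodule.subset_span ⟨_, hl _ (l.get_mem i), rfl⟩⟩, ?_⟩)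
        rw [← List.ofFn_get (l.map (ι F))]
        simp
      exact mul_eq_zero_comm_of_mem_exteriorPower hω (hpow r hl') (h _ hl')
    · refine mul_eq_zero_comm_of_mem_exteriorPower (hpow r hx) hω ?_
      have hle : ⨆ c : Fin (k - r + 1) ↪o Fin k,
          LinearMap.range (LinearMap.mulLeft F (dwedge F fun j => a (c j))) ≤
          LinearMap.ker (LinearMap.mulLeft F x) := by
        refine iSup_le fun c => ?_
        rintro _ ⟨y, rfl⟩
        have hc : (dwedge F fun j => a (c j)) ∈ (Submodule.span F
            (ι F '' Set.range fun i => KaehlerDifferential.D ℤ F (a i))) ^ (k - r + 1) :=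
          Submodule.pow_subset_pow _ (Set.mem_pow.2
            ⟨fun j => ⟨_, Submodule.subset_span ⟨_, ⟨c j, rfl⟩, rfl⟩⟩, rfl⟩)
        have hxc := Submodule.mul_mem_mul hx hc
        rw [← pow_add, span_image_ι_range_pow_eq_bot _ (by lia), Submodule.mem_bot] at hxc
        rw [LinearMap.mem_ker, LinearMap.mulLeft_apply, LinearMap.mulLeft_apply, ← mul_assoc, hxc,
          zero_mul]
      exact hle h
  · ext ω
    rw [mem_annOmega_dSet_iff hgen, span_image_ι_range_pow_eq_bot _ hr]
    simp [OmegaPow]
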